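/- For every even integer d ≥ 0, the degree-d homogeneous component of the coinvariant space (ℚ[x,y]^even)_{S_3} has ℚ-dimension ⌊(d+1)/6⌋. (Equivalently, the weight-k part of the first cohomology of the two-loop graph complex has dimension ⌊k/6⌋ for odd k = d+1 and vanishes for even k.) -/

import Mathlib

open MvPolynomial

noncomputable section

/-- The signed action of `S₃` on `ℚ[x,y,z]`:
`σ.(x^{k₁}y^{k₂}z^{k₃}) = sgn(σ) · x^{k_{σ(1)}}y^{k_{σ(2)}}z^{k_{σ(3)}}`. -/
def act3 (σ : Equiv.Perm (Fin 3)) (p : MvPolynomial (Fin 3) ℚ) : MvPolynomial (Fin 3) ℚ :=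
  (Equiv.Perm.sign σ : ℤ) • rename (⇑σ⁻¹) p

/-- The algebra map `φ : ℚ[x,y,z] → ℚ[x,y]`, `x ↦ x`, `y ↦ y`, `z ↦ -x-y`. -/
def phi : MvPolynomial (Fin 3) ℚ →ₐ[ℚ] MvPolynomial (Fin 2) ℚ :=
  aeval ![X 0, X 1, - X 0 - X 1]

/-- The subspace of even polynomials. -/
def evenSub (n : ℕ) : Submodule ℚ (MvPolynomial (Fin n) ℚ) where
  carrier := {p | ∀ d ∈ p.support, Even (d.sum fun _ e => e)}
  add_mem' := by
    intro p q hp hq d hd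
    rcases Finset.mem_union.mp (support_add hd) with h | h
    · exact hp d h
    · exact hq d h
  zero_mem' := by simp
  smul_mem' := by
    intro c p hp d hd
    exact hp d (support_smul hd)

/-- The map `σ_* : ℚ[x,y] → ℚ[x,y]` defined by `σ_*(x^{k₁}y^{k₂}) = φ(σ.(x^{k₁}y^{k₂}z⁰))`,
extended linearly. -/
def star3 (σ : Equiv.Perm (Fin 3)) (p : MvPolynomial (Fin 2) ℚ) : MvPolynomial (Fin 2) ℚ :=
  phi (act3 σ (rename (Fin.castSucc : Fin 2 → Fin 3) p))

/-- The relation subspace `R = span{σ_* v - v | σ ∈ S₃, v ∈ ℚ[x,y]^even}`. -/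
def Rrel : Submodule ℚ (MvPolynomial (Fin 2) ℚ) :=
  Submodule.span ℚ {w | ∃ (σ : Equiv.Perm (Fin 3)) (v : MvPolynomial (Fin 2) ℚ),
    v ∈ evenSub 2 ∧ w = star3 σ v - v}

/-- The linear form `φ(X i)`. -/
def lform (i : Fin 3) : MvPolynomial (Fin 2) ℚ := phi (X i)

lemma lform0 : lform 0 = X 0 := by simp [lform, phi]
lemma lform1 : lform 1 = X 1 := by simp [lform, phi]
lemma lform2 : lform 2 = - X 0 - X 1 := by simp [lform, phi]

lemma lform_hom (i : Fin 3) : (lform i).IsHomogeneous 1 := by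
  fin_cases i
  · simpa [lform0] using isHomogeneous_X ℚ (0 : Fin 2)
  · simpa [lform1] using isHomogeneous_X ℚ (1 : Fin 2)
  · show (lform 2).IsHomogeneous 1
    rw [lform2]
    exact ((isHomogeneous_X ℚ (0 : Fin 2)).neg).sub (isHomogeneous_X ℚ (1 : Fin 2))

/-- The unsigned algebra map. -/
def alg (σ : Equiv.Perm (Fin 3)) : MvPolynomial (Fin 2) ℚ →ₐ[ℚ] MvPolynomial (Fin 2) ℚ :=
  phi.comp ((rename (⇑σ⁻¹)).comp (rename Fin.castSucc))

lemma alg_X (σ : Equiv.Perm (Fin 3)) (i : Fin 2) : alg σ (X i) = lform (σ⁻¹ i.castSucc) := by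
  simp [alg, lform]

lemma alg_eq_aeval (σ : Equiv.Perm (Fin 3)) :
    alg σ = aeval (fun i : Fin 2 => lform (σ⁻¹ i.castSucc)) := by
  ext i : 1
  rw [alg_X, aeval_X]

/-- The sign as a rational. -/
def sg (σ : Equiv.Perm (Fin 3)) : ℚ := ((Equiv.Perm.sign σ : ℤ) : ℚ)

/-- `star3 σ` as a linear map. -/
def signedStar (σ : Equiv.Perm (Fin 3)) : MvPolynomial (Fin 2) ℚ →ₗ[ℚ] MvPolynomial (Fin 2) ℚ :=
  sg σ • (alg σ).toLinearMap

lemma signedStar_apply (σ : Equiv.Perm (Fin 3)) (p) : signedStar σ p = star3 σ p := by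
  simp [signedStar, star3, act3, alg, sg, Int.cast_smul_eq_zsmul]

lemma lform_sum : lform 0 + lform 1 + lform 2 = 0 := by
  rw [lform0, lform1, lform2]; ring

lemma lform_perm_sum (σ : Equiv.Perm (Fin 3)) :
    lform (σ 0) + lform (σ 1) + lform (σ 2) = 0 := by
  have h := Equiv.sum_comp σ lform
  simpa [Fin.sum_univ_three, lform_sum] using h

lemma phi_incl_phi (σ : Equiv.Perm (Fin 3)) :
    (phi.comp (rename (⇑σ))).comp ((rename Fin.castSucc).comp phi) = phi.comp (rename (⇑σ)) := by
  ext i : 1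
  fin_cases i
  · simp [phi]
  · simp [phi]
  · have h := lform_perm_sum σ
    have e : (phi (X 2) : MvPolynomial (Fin 2) ℚ) = - X 0 - X 1 := lform2
    simp only [AlgHom.comp_apply, Fin.reduceFinMk, e, rename_X, map_sub, map_neg]
    simp only [lform] at h
    simp only [Fin.castSucc_zero, Fin.castSucc_one]
    linear_combination -h

lemma alg_mul (σ τ : Equiv.Perm (Fin 3)) : (alg τ).comp (alg σ) = alg (σ * τ) := by
  have h := phi_incl_phi τ⁻¹
  apply AlgHom.ext
  intro p
  have h2 := DFunLike.congr_fun h (rename (⇑σ⁻¹) (rename Fin.castSucc p))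
  simp only [AlgHom.comp_apply] at h2
  simp only [alg, AlgHom.comp_apply]
  rw [h2]
  simp only [rename_rename, mul_inv_rev, Equiv.Perm.coe_mul, Function.comp_assoc]

lemma sg_mul (σ τ) : sg (σ * τ) = sg σ * sg τ := by simp [sg]

lemma signedStar_mul (σ τ : Equiv.Perm (Fin 3)) : signedStar τ ∘ₗ signedStar σ = signedStar (σ * τ) := by
  apply LinearMap.ext
  intro p
  simp only [signedStar, LinearMap.comp_apply, LinearMap.smul_apply, AlgHom.toLinearMap_apply,
    map_smul, smul_smul, sg_mul, ← alg_mul, AlgHom.comp_apply]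
  

/-- The averaging operator. -/
def avg : MvPolynomial (Fin 2) ℚ →ₗ[ℚ] MvPolynomial (Fin 2) ℚ := (1/6 : ℚ) • ∑ σ, signedStar σ

lemma avg_star (σ) (p) : avg (signedStar σ p) = avg p := by
  simp only [avg, LinearMap.smul_apply, LinearMap.sum_apply]
  have : ∀ τ, signedStar τ (signedStar σ p) = signedStar (σ * τ) p := fun τ => by
    rw [← signedStar_mul]; rfl
  simp only [this]
  have h := Equiv.sum_comp (Equiv.mulLeft σ) (fun τ => signedStar τ p)
  simp only [Equiv.coe_mulLeft] at h
  rw [h]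

lemma avg_avg (p) : avg (avg p) = avg p := by
  conv_lhs => rw [show avg p = (1/6 : ℚ) • ∑ σ, signedStar σ p by simp [avg]]
  rw [map_smul, map_sum]
  simp only [avg_star]
  rw [Finset.sum_const, Finset.card_univ, Fintype.card_perm, Fintype.card_fin,
    ← Nat.cast_smul_eq_nsmul ℚ, smul_smul]
  norm_num [Nat.factorial]

lemma Rrel_le : Rrel ≤ LinearMap.ker avg := by
  rw [Rrel, Submodule.span_le]
  rintro w ⟨σ, v, -, rfl⟩
  simp [← signedStar_apply, avg_star]

lemma mem_Rrel (v) (hv : v ∈ evenSub 2) (h : avg v = 0) : v ∈ Rrel := by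
  have : v = (-(1/6) : ℚ) • ∑ σ : Equiv.Perm (Fin 3), (star3 σ v - v) := by
    have h' : (1/6 : ℚ) • ∑ σ, signedStar σ v = 0 := by rw [← h]; simp [avg]
    rw [Finset.sum_sub_distrib, smul_sub]
    simp only [← signedStar_apply]
    rw [neg_smul, h', Finset.sum_const, Finset.card_univ, Fintype.card_perm, Fintype.card_fin,
      ← Nat.cast_smul_eq_nsmul ℚ, smul_smul]
    norm_num [Nat.factorial]
  rw [this]
  refine Submodule.smul_mem _ _ (Submodule.sum_mem _ fun σ _ => Submodule.subset_span ⟨σ, v, hv, rfl⟩)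

lemma signedStar_hom (d : ℕ) (σ) (p) (hp : p ∈ homogeneousSubmodule (Fin 2) ℚ d) :
    signedStar σ p ∈ homogeneousSubmodule (Fin 2) ℚ d := by
  refine Submodule.smul_mem _ _ ?_
  rw [mem_homogeneousSubmodule] at hp ⊢
  have := hp.aeval (fun i : Fin 2 => lform (σ⁻¹ i.castSucc)) (fun i => lform_hom _)
  simpa [alg_eq_aeval] using this

lemma hom_even (d : ℕ) (hd : Even d) (p) (hp : p ∈ homogeneousSubmodule (Fin 2) ℚ d) :
    p ∈ evenSub 2 := by
  intro m hm
  have := hp (mem_support_iff.mp hm)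
  rw [Finsupp.weight_apply] at this
  simp only [Pi.one_apply, smul_eq_mul, mul_one] at this
  rwa [this]

/-- Restriction to degree `d`. -/
def starD (d : ℕ) (σ : Equiv.Perm (Fin 3)) : Module.End ℚ (homogeneousSubmodule (Fin 2) ℚ d) :=
  (signedStar σ).restrict (signedStar_hom d σ)

/-- Averaging in degree `d`. -/
def avgD (d : ℕ) : Module.End ℚ (homogeneousSubmodule (Fin 2) ℚ d) :=
  (1/6 : ℚ) • ∑ σ, starD d σ

lemma avgD_coe (d) (p) : ((avgD d p : homogeneousSubmodule (Fin 2) ℚ d) : MvPolynomial (Fin 2) ℚ) = avg p := by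
  simp [avgD, avg, starD, LinearMap.sum_apply]

/-- The exponent `(a,b)`. -/
def ex (a b : ℕ) : Fin 2 →₀ ℕ := Finsupp.single 0 a + Finsupp.single 1 b

lemma ex_inj {a b c d : ℕ} : ex a b = ex c d ↔ a = c ∧ b = d := by
  constructor
  · intro h
    have h0 := DFunLike.congr_fun h 0
    have h1 := DFunLike.congr_fun h 1
    simpa [ex] using And.intro h0 h1
  · rintro ⟨rfl, rfl⟩; rfl

lemma mon_ex (a b : ℕ) : (X 0 ^ a * X 1 ^ b : MvPolynomial (Fin 2) ℚ) = monomial (ex a b) 1 := by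
  simp [ex, X_pow_eq_monomial, monomial_mul]

lemma coeff_gen (p q r a b : ℕ) (h : p + q + r = a + b) :
    coeff (ex a b) (X 0 ^ p * X 1 ^ q * (- X 0 - X 1) ^ r : MvPolynomial (Fin 2) ℚ) =
      if p ≤ a then (-1) ^ r * (r.choose (a - p) : ℚ) else 0 := by
  have : (X 0 ^ p * X 1 ^ q * (- X 0 - X 1) ^ r : MvPolynomial (Fin 2) ℚ) =
      ∑ m ∈ Finset.range (r + 1), ((-1) ^ r * (r.choose m : ℚ)) •
        monomial (ex (p + m) (q + (r - m))) (1 : ℚ) := by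
    rw [show (- X 0 - X 1 : MvPolynomial (Fin 2) ℚ) = (-1) * (X 0 + X 1) by ring, mul_pow, add_pow,
      Finset.mul_sum, Finset.mul_sum]
    refine Finset.sum_congr rfl fun m _ => ?_
    rw [← mon_ex, smul_eq_C_mul]
    simp only [map_mul, map_pow, map_neg, map_one, map_natCast]
    ring
  rw [this, coeff_sum]
  simp only [coeff_smul, coeff_monomial, ex_inj, smul_eq_mul, mul_ite, mul_one, mul_zero]
  split_ifs with hpa
  · by_cases hr : a - p ≤ r
    · rw [Finset.sum_eq_single (a - p)]
      · rw [if_pos (by omega)]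
      · intro m _ hm
        rw [if_neg (by omega)]
      · intro hm
        simp at hm; omega
    · rw [Nat.choose_eq_zero_of_lt (by omega)]
      simp only [Nat.cast_zero, mul_zero]
      refine Finset.sum_eq_zero fun m hm => ?_
      simp at hm
      rw [if_neg (by omega)]
  · refine Finset.sum_eq_zero fun m hm => ?_
    rw [if_neg (by omega)]

/-- The index set of the monomial basis. -/
abbrev Idx (d : ℕ) := {x : ℕ × ℕ // x ∈ Finset.HasAntidiagonal.antidiagonal d}

lemma mon_hom (d : ℕ) (x : Idx d) :
    (monomial (ex x.1.1 x.1.2) (1 : ℚ)) ∈ homogeneousSubmodule (Fin 2) ℚ d := by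
  obtain ⟨⟨a, b⟩, h⟩ := x
  rw [Finset.HasAntidiagonal.mem_antidiagonal] at h
  rw [mem_homogeneousSubmodule, ← mon_ex]
  have := (isHomogeneous_X_pow (R := ℚ) (0 : Fin 2) a).mul (isHomogeneous_X_pow (1 : Fin 2) b)
  rwa [h] at this

lemma ex_surj (m : Fin 2 →₀ ℕ) : m = ex (m 0) (m 1) := by
  ext i; fin_cases i <;> simp [ex]

lemma coeff_zero_of (d : ℕ) (p) (hp : p ∈ homogeneousSubmodule (Fin 2) ℚ d) (m : Fin 2 →₀ ℕ)
    (h : m 0 + m 1 ≠ d) : coeff m p = 0 := by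
  by_contra hc
  have := hp hc
  rw [Finsupp.weight_apply, Finsupp.sum_fintype _ _ (by simp)] at this
  simp at this
  exact h this

/-- The coordinate isomorphism. -/
def coordE (d : ℕ) : homogeneousSubmodule (Fin 2) ℚ d ≃ₗ[ℚ] (Idx d → ℚ) where
  toFun p x := coeff (ex x.1.1 x.1.2) p.1
  map_add' p q := by ext; simp
  map_smul' c p := by ext; simp
  invFun f := ∑ x, f x • ⟨monomial (ex x.1.1 x.1.2) (1 : ℚ), mon_hom d x⟩
  left_inv p := by
    apply Subtype.ext
    ext m
    simp only [Submodule.coe_sum, Submodule.coe_smul, coeff_sum, coeff_smul, coeff_monomial]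
    by_cases h : m 0 + m 1 = d
    · rw [Finset.sum_eq_single ⟨(m 0, m 1), by simpa using h⟩]
      · simp [← ex_surj]
      · intro y _ hy
        rw [if_neg, smul_zero]
        intro he
        rw [ex_surj m, ex_inj] at he
        exact hy (Subtype.ext (Prod.ext he.1 he.2))
      · simp
    · rw [coeff_zero_of d _ p.2 m h]
      refine Finset.sum_eq_zero fun y _ => ?_
      rw [if_neg, smul_zero]
      intro he
      have hy := Finset.HasAntidiagonal.mem_antidiagonal.mp y.2
      rw [ex_surj m, ex_inj] at he
      omega
  right_inv f := by
    ext y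
    simp only [Submodule.coe_sum, Submodule.coe_smul, coeff_sum, coeff_smul, coeff_monomial]
    rw [Finset.sum_eq_single y]
    · simp
    · intro z _ hz
      rw [if_neg, smul_zero]
      intro he
      rw [ex_inj] at he
      exact hz (Subtype.ext (Prod.ext he.1 he.2))
    · simp

/-- The monomial basis. -/
def bas (d : ℕ) : Module.Basis (Idx d) ℚ (homogeneousSubmodule (Fin 2) ℚ d) :=
  Module.Basis.ofEquivFun (coordE d)

lemma bas_apply (d) (x : Idx d) : ((bas d x : homogeneousSubmodule (Fin 2) ℚ d) :
    MvPolynomial (Fin 2) ℚ) = X 0 ^ x.1.1 * X 1 ^ x.1.2 := by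
  rw [mon_ex]
  have : bas d x = ⟨monomial (ex x.1.1 x.1.2) (1 : ℚ), mon_hom d x⟩ := by
    apply (bas d).repr.injective
    rw [Module.Basis.repr_self]
    ext y
    simp only [bas, Module.Basis.ofEquivFun_repr_apply]
    simp only [coordE, LinearEquiv.coe_mk, LinearMap.coe_mk, AddHom.coe_mk, coeff_monomial, ex_inj,
      Finsupp.single_apply]
    refine if_congr ?_ rfl rfl
    rw [Subtype.ext_iff, Prod.ext_iff]
  rw [this]

lemma bas_repr (d) (p) (x : Idx d) : (bas d).repr p x = coeff (ex x.1.1 x.1.2) p.1 := by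
  simp [bas, coordE]

lemma trace_starD (d : ℕ) (σ : Equiv.Perm (Fin 3)) :
    LinearMap.trace ℚ _ (starD d σ) = ∑ x ∈ Finset.HasAntidiagonal.antidiagonal d,
      sg σ * coeff (ex x.1 x.2) (lform (σ⁻¹ 0) ^ x.1 * lform (σ⁻¹ 1) ^ x.2) := by
  rw [LinearMap.trace_eq_matrix_trace ℚ (bas d), Matrix.trace,
    ← Finset.sum_coe_sort (Finset.HasAntidiagonal.antidiagonal d)]
  refine Finset.sum_congr rfl fun x _ => ?_
  rw [Matrix.diag_apply, LinearMap.toMatrix_apply, bas_repr]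
  simp only [starD, LinearMap.coe_restrict_apply, bas_apply, signedStar, LinearMap.smul_apply,
    AlgHom.toLinearMap_apply, map_mul, map_pow, alg_X, coeff_smul, smul_eq_mul]
  rfl

/-- The alternating diagonal binomial sum. -/
def tsum3 (d : ℕ) : ℚ := ∑ x ∈ Finset.HasAntidiagonal.antidiagonal d, (-1) ^ x.2 * (x.2.choose x.1 : ℚ)

lemma tsum3_rec (d : ℕ) : tsum3 (d + 2) = - tsum3 (d + 1) - tsum3 d := by
  have h1 : tsum3 (d + 2) = (-1) ^ (d+2) + ∑ x ∈ Finset.HasAntidiagonal.antidiagonal (d+1),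
      (-1) ^ x.2 * (x.2.choose (x.1 + 1) : ℚ) := by
    rw [tsum3, Finset.Nat.sum_antidiagonal_succ]; simp
  have h2 : tsum3 (d + 1) = (-1) ^ (d+1) + ∑ x ∈ Finset.HasAntidiagonal.antidiagonal d,
      (-1) ^ x.2 * (x.2.choose (x.1 + 1) : ℚ) := by
    rw [tsum3, Finset.Nat.sum_antidiagonal_succ]; simp
  rw [h1, h2, tsum3, Finset.Nat.sum_antidiagonal_succ']
  have h3 : ∀ x : ℕ × ℕ, (-1 : ℚ) ^ (x.2 + 1) * ((x.2 + 1).choose (x.1 + 1) : ℚ) =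
      - ((-1) ^ x.2 * (x.2.choose x.1 : ℚ)) - (-1) ^ x.2 * (x.2.choose (x.1 + 1) : ℚ) := by
    intro x
    rw [Nat.choose_succ_succ]; push_cast; ring
  simp only [h3, Finset.sum_sub_distrib, Finset.sum_neg_distrib]
  simp
  ring

lemma tsum3_vals (k : ℕ) : tsum3 (3*k) = 1 ∧ tsum3 (3*k+1) = -1 := by
  induction k with
  | zero =>
    constructor
    · simp [tsum3]
    · simp [tsum3, Finset.Nat.antidiagonal_succ]
  | succ k ih =>
    have a := tsum3_rec (3*k)
    have b := tsum3_rec (3*k+1)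
    have c := tsum3_rec (3*k+2)
    rw [show 3*k+1+1 = 3*k+2 by ring] at b
    rw [show 3*k+1+2 = 3*k+3 by ring] at b
    rw [show 3*k+2+1 = 3*k+3 by ring, show 3*k+2+2=3*k+4 by ring] at c
    rw [show 3*(k+1) = 3*k+3 by ring, show 3*k+3+1 = 3*k+4 by ring]
    constructor <;> linarith [ih.1, ih.2]

lemma alt_sum (d : ℕ) (hd : Even d) : ∑ x ∈ Finset.HasAntidiagonal.antidiagonal d, (-1 : ℚ) ^ x.1 = 1 := by
  rw [Finset.Nat.sum_antidiagonal_eq_sum_range_succ_mk]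
  simp only
  rw [neg_one_geom_sum, if_neg]
  simpa [Nat.even_add_one] using hd

lemma alt_sum' (d : ℕ) (hd : Even d) : ∑ x ∈ Finset.HasAntidiagonal.antidiagonal d, (-1 : ℚ) ^ x.2 = 1 := by
  rw [← Finset.Nat.sum_antidiagonal_swap]
  exact alt_sum d hd

lemma tr_of (d : ℕ) (σ : Equiv.Perm (Fin 3)) (s : ℚ) (i j : Fin 3) (f : ℕ × ℕ → ℚ)
    (hs : sg σ = s) (hi : σ⁻¹ 0 = i) (hj : σ⁻¹ 1 = j)
    (h : ∀ a b : ℕ, coeff (ex a b) (lform i ^ a * lform j ^ b) = f (a, b)) :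
    LinearMap.trace ℚ _ (starD d σ) = s * ∑ x ∈ Finset.HasAntidiagonal.antidiagonal d, f x := by
  rw [trace_starD, hs, hi, hj, Finset.mul_sum]
  exact Finset.sum_congr rfl fun x _ => by rw [h]

lemma trace_one (d : ℕ) : LinearMap.trace ℚ _ (starD d 1) = d + 1 := by
  rw [tr_of d 1 1 0 1 (fun _ => 1) (by simp [sg]) rfl rfl]
  · simp
  · intro a b
    have := coeff_gen a b 0 a b rfl
    simpa [lform0, lform1] using this

lemma trace_01 (d : ℕ) (hd : Even d) :
    LinearMap.trace ℚ _ (starD d (Equiv.swap 0 1)) = -1 := by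
  rw [tr_of d _ (-1) 1 0 (fun x => if x.1 = x.2 then 1 else 0)
    (by simp [sg]) (by decide) (by decide)]
  · obtain ⟨k, rfl⟩ := hd
    rw [Finset.sum_eq_single (k, k)]
    · simp
    · rintro ⟨a, b⟩ h hne
      simp only [Finset.HasAntidiagonal.mem_antidiagonal] at h
      rw [if_neg]
      intro hab
      apply hne
      rw [Prod.mk.injEq]; omega
    · simp
  · intro a b
    rw [lform0, lform1, mul_comm, mon_ex, coeff_monomial]
    simp only [ex_inj]
    congr 1
    simp; omega

lemma trace_02 (d : ℕ) (hd : Even d) :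
    LinearMap.trace ℚ _ (starD d (Equiv.swap 0 2)) = -1 := by
  rw [tr_of d _ (-1) 2 1 (fun x => (-1) ^ x.1) (by simp [sg]) (by decide) (by decide), alt_sum d hd]
  · simp
  · intro a b
    have := coeff_gen 0 b a a b (by omega)
    rw [lform1, lform2, mul_comm]
    simpa using this

lemma trace_12 (d : ℕ) (hd : Even d) :
    LinearMap.trace ℚ _ (starD d (Equiv.swap 1 2)) = -1 := by
  rw [tr_of d _ (-1) 0 2 (fun x => (-1) ^ x.2) (by simp [sg]) (by decide) (by decide),
    alt_sum' d hd]
  · simp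
  · intro a b
    have := coeff_gen a 0 b a b (by omega)
    rw [lform0, lform2]
    simpa using this

lemma trace_c1 (d : ℕ) :
    LinearMap.trace ℚ _ (starD d (Equiv.swap 0 1 * Equiv.swap 1 2)) = tsum3 d := by
  rw [tr_of d _ 1 2 0 (fun x => (-1) ^ x.1 * (x.1.choose x.2 : ℚ))
    (by simp [sg_mul]; simp [sg]) (by decide) (by decide), one_mul, tsum3,
    ← Finset.Nat.sum_antidiagonal_swap]
  · rfl
  · intro a b
    have := coeff_gen b 0 a a b (by omega)
    rw [lform0, lform2, mul_comm]
    simp only [pow_zero, mul_one] at this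
    rw [this]
    split_ifs with h
    · simp [Nat.choose_symm h]
    · rw [Nat.choose_eq_zero_of_lt (by omega)]; simp

lemma trace_c2 (d : ℕ) :
    LinearMap.trace ℚ _ (starD d (Equiv.swap 1 2 * Equiv.swap 0 1)) = tsum3 d := by
  rw [tr_of d _ 1 1 2 (fun x => (-1) ^ x.2 * (x.2.choose x.1 : ℚ))
    (by simp [sg_mul]; simp [sg]) (by decide) (by decide), one_mul, tsum3]
  intro a b
  have := coeff_gen 0 a b a b (by omega)
  rw [lform1, lform2]
  simpa using this

lemma univ_perm3 : (Finset.univ : Finset (Equiv.Perm (Fin 3))) =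
    {1, Equiv.swap 0 1, Equiv.swap 0 2, Equiv.swap 1 2, Equiv.swap 0 1 * Equiv.swap 1 2,
      Equiv.swap 1 2 * Equiv.swap 0 1} := by decide

lemma trace_avgD (d : ℕ) (hd : Even d) :
    LinearMap.trace ℚ _ (avgD d) = (1/6) * (d + 1 - 3 + 2 * tsum3 d) := by
  rw [avgD, map_smul, map_sum, univ_perm3, Finset.sum_insert (by decide),
    Finset.sum_insert (by decide), Finset.sum_insert (by decide), Finset.sum_insert (by decide),
    Finset.sum_insert (by decide), Finset.sum_singleton, trace_one, trace_01 d hd, trace_02 d hd,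
    trace_12 d hd, trace_c1, trace_c2, smul_eq_mul]
  ring

lemma trace_val (d : ℕ) (hd : Even d) :
    LinearMap.trace ℚ _ (avgD d) = (((d + 1) / 6 : ℕ) : ℚ) := by
  rw [trace_avgD d hd]
  obtain ⟨k, hk⟩ := hd
  have h3 : d = 6 * (d / 6) ∨ d = 6 * (d / 6) + 2 ∨ d = 6 * (d / 6) + 4 := by omega
  generalize d / 6 = q at h3
  rcases h3 with h | h | h
  · have e : tsum3 d = 1 := by rw [h, show 6 * q = 3 * (2 * q) by ring]; exact (tsum3_vals _).1
    rw [e, show (d + 1) / 6 = q by omega, h]; push_cast; ring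
  · have e : tsum3 d = 0 := by
      rw [h, show 6 * q + 2 = 3 * (2 * q) + 2 by ring, tsum3_rec]
      rw [(tsum3_vals _).1, (tsum3_vals _).2]; norm_num
    rw [e, show (d + 1) / 6 = q by omega, h]; push_cast; ring
  · have e : tsum3 d = -1 := by
      rw [h, show 6 * q + 4 = 3 * (2 * q + 1) + 1 by ring]; exact (tsum3_vals _).2
    rw [e, show (d + 1) / 6 = q by omega, h]; push_cast; ring

lemma comap_eq (d : ℕ) (hd : Even d) :
    Rrel.comap (homogeneousSubmodule (Fin 2) ℚ d).subtype = LinearMap.ker (avgD d) := by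
  ext p
  rw [Submodule.mem_comap, LinearMap.mem_ker, ← Submodule.coe_eq_zero, avgD_coe]
  constructor
  · intro h
    exact Rrel_le h
  · intro h
    exact mem_Rrel _ (hom_even d hd _ p.2) h

lemma finrank_quot_ker {V : Type*} [AddCommGroup V] [Module ℚ V] [Module.Finite ℚ V]
    (f : V →ₗ[ℚ] V) (hf : ∀ x, f (f x) = f x) :
    (Module.finrank ℚ (V ⧸ LinearMap.ker f) : ℚ) = LinearMap.trace ℚ V f := by
  have hp : LinearMap.IsProj (LinearMap.range f) f := by
    constructor
    · intro x
      exact ⟨x, rfl⟩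
    · rintro _ ⟨y, rfl⟩
      exact hf y
  rw [f.quotKerEquivRange.finrank_eq, hp.trace]

/-- For every even `d`, the degree-`d` component of the coinvariant space
`(ℚ[x,y]^even)_{S₃}` has dimension `⌊(d+1)/6⌋`. -/
theorem dim_coinvariants_even_component :
    ∀ d : ℕ, Even d →
      Module.finrank ℚ
        (↥(homogeneousSubmodule (Fin 2) ℚ d) ⧸
          (Rrel.comap (homogeneousSubmodule (Fin 2) ℚ d).subtype)) = (d + 1) / 6 := by
  intro d hd
  have : Module.Finite ℚ (homogeneousSubmodule (Fin 2) ℚ d) := Module.Finite.of_basis (bas d)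
  rw [comap_eq d hd]
  have h := finrank_quot_ker (avgD d) (fun x => by
    apply Subtype.ext
    rw [avgD_coe, avgD_coe, avg_avg])
  rw [trace_val d hd] at h
  exact_mod_cast h

end
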